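/- Let 𝓗 be an arrangement of topoplanes in ℝⁿ and let H₁, H₂ ∈ 𝓗 be distinct with H₁ ∩ H₂ ≠ ∅. Let X₊ be a connected component of ℝⁿ ∖ H₁ (so X₊ is homeomorphic to ℝⁿ) and let Z₊ be a connected component of H₂ ∖ H₁ with Z₊ ⊆ X₊. Then Z₊ is a relative topoplane in X₊. -/

import Mathlib

open Set

/-- The `i`-th coordinate hyperplane in `ℝⁿ` (by convention the whole space if `i ≥ n`). -/
def coordHyp (n i : ℕ) : Set (Fin n → ℝ) := {x | ∀ h : i < n, x ⟨i, h⟩ = 0}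

/-- `H` is a topological hyperplane (topoplane) in `ℝⁿ`: some self-homeomorphism of `ℝⁿ`
carries `H` onto the coordinate hyperplane `{x | x₁ = 0}`. -/
def IsTopoplane {n : ℕ} (H : Set (Fin n → ℝ)) : Prop :=
  ∃ e : (Fin n → ℝ) ≃ₜ (Fin n → ℝ), e '' H = coordHyp n 0

/-- `Z` is a relative topoplane in `Y ⊆ ℝⁿ`: `Z ⊆ Y` and some homeomorphism of `Y`
(with the subspace topology) onto some `ℝᵈ`, `d ≥ 1`, carries `Z` onto `{x | x₁ = 0}`. -/
def IsRelTopoplane {n : ℕ} (Y Z : Set (Fin n → ℝ)) : Prop :=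
  Z ⊆ Y ∧ ∃ d : ℕ, 1 ≤ d ∧ ∃ φ : Y ≃ₜ (Fin d → ℝ),
    φ '' {y : Y | (y : Fin n → ℝ) ∈ Z} = coordHyp d 0

/-- `Y` is a flat of the family `𝓗`: a nonempty intersection of a subfamily of `𝓗`
(the empty intersection being all of `ℝⁿ`). -/
def IsFlat {n : ℕ} (𝓗 : Set (Set (Fin n → ℝ))) (Y : Set (Fin n → ℝ)) : Prop :=
  (∃ 𝓢 ⊆ 𝓗, Y = ⋂₀ 𝓢) ∧ Y.Nonempty

/-- `𝓗` is an arrangement of topoplanes in `ℝⁿ`: a finite set of topoplanes such that for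
every `H ∈ 𝓗` and every flat `Y`, either `Y ⊆ H`, or `H ∩ Y = ∅`, or `H ∩ Y` is a
relative topoplane in `Y`. -/
def IsArrangement {n : ℕ} (𝓗 : Set (Set (Fin n → ℝ))) : Prop :=
  𝓗.Finite ∧ (∀ H ∈ 𝓗, IsTopoplane H) ∧
    ∀ H ∈ 𝓗, ∀ Y : Set (Fin n → ℝ), IsFlat 𝓗 Y →
      Y ⊆ H ∨ H ∩ Y = ∅ ∨ IsRelTopoplane Y (H ∩ Y)

/-- `Y` has dimension `d`: it is homeomorphic, in the subspace topology, to `ℝᵈ`. -/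
def HasDim {n : ℕ} (Y : Set (Fin n → ℝ)) (d : ℕ) : Prop :=
  Nonempty (Y ≃ₜ (Fin d → ℝ))

/-- Topoplanes `H₁`, `H₂` cross: some self-homeomorphism of `ℝⁿ` carries them
simultaneously onto the coordinate hyperplanes `{x | x₁ = 0}` and `{x | x₂ = 0}`. -/
def Crosses {n : ℕ} (H₁ H₂ : Set (Fin n → ℝ)) : Prop :=
  ∃ e : (Fin n → ℝ) ≃ₜ (Fin n → ℝ), e '' H₁ = coordHyp n 0 ∧ e '' H₂ = coordHyp n 1

/-- The pairwise condition for an arrangement to be affine: any two distinct members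
are disjoint or cross. -/
def PairwiseAffine {n : ℕ} (𝓗 : Set (Set (Fin n → ℝ))) : Prop :=
  ∀ H₁ ∈ 𝓗, ∀ H₂ ∈ 𝓗, H₁ ≠ H₂ → H₁ ∩ H₂ = ∅ ∨ Crosses H₁ H₂

section

open scoped Real

/-- The map `W × ℂ → W × ℂ` that exponentiates the complex coordinate; its restriction to the
complement of `W × {0}` in the codomain is the universal covering. -/
noncomputable def expSnd (W : Type*) (a : W × ℂ) : W × ℂ := (a.1, Complex.exp a.2)

theorem continuous_expSnd {W : Type*} [TopologicalSpace W] : Continuous (expSnd W) := by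
  unfold expSnd
  fun_prop

theorem expSnd_snd_ne_zero {W : Type*} (a : W × ℂ) : (expSnd W a).2 ≠ 0 := Complex.exp_ne_zero _

/-- Uniqueness of lifts through `expSnd`. -/
theorem eq_of_expSnd_comp_eq {A W : Type*} [TopologicalSpace A] [PreconnectedSpace A]
    [TopologicalSpace W] {g₁ g₂ : A → W × ℂ} (h₁ : Continuous g₁) (h₂ : Continuous g₂)
    (he : ∀ a, expSnd W (g₁ a) = expSnd W (g₂ a)) (a₀ : A) (h₀ : g₁ a₀ = g₂ a₀) : g₁ = g₂ := by
  have h : (fun a ↦ (g₁ a).2) = fun a ↦ (g₂ a).2 := by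
    refine Complex.isCoveringMap_exp.eq_of_comp_eq (by fun_prop) (by fun_prop) ?_ a₀ (by rw [h₀])
    funext a
    exact Subtype.ext (show (expSnd W (g₁ a)).2 = (expSnd W (g₂ a)).2 by rw [he a])
  funext a
  exact Prod.ext (show (expSnd W (g₁ a)).1 = (expSnd W (g₂ a)).1 by rw [he a]) (congrFun h a)

/-- Existence of lifts through `expSnd`. -/
theorem exists_lift_expSnd {A W : Type*} [TopologicalSpace A] [SimplyConnectedSpace A]
    [LocallyPathConnectedSpace A] [TopologicalSpace W] {g : A → W × ℂ} (hg : Continuous g)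
    (hg0 : ∀ a, (g a).2 ≠ 0) (a₀ : A) (b₀ : W × ℂ) (h₀ : expSnd W b₀ = g a₀) :
    ∃ l : A → W × ℂ, Continuous l ∧ l a₀ = b₀ ∧ ∀ a, expSnd W (l a) = g a := by
  obtain ⟨l, ⟨hl0, hl⟩, -⟩ := Complex.isCoveringMapOn_exp.existsUnique_continuousMap_lifts
    ⟨fun a ↦ (g a).2, by fun_prop⟩ (a₀ := a₀) (e₀ := b₀.2) (congrArg Prod.snd h₀) hg0
  refine ⟨fun a ↦ ((g a).1, l a), by fun_prop, ?_, fun a ↦ ?_⟩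
  · exact Prod.ext (congrArg Prod.fst h₀).symm hl0
  · exact Prod.ext rfl (congrFun hl a)

/-- A homeomorphism `W' × ℂ ≃ₜ W × ℂ` preserving the zero sections lifts to the universal covers
of the complements of the zero sections. -/
theorem exists_homeomorph_lift_expSnd {W W' : Type*} [TopologicalSpace W] [TopologicalSpace W']
    [LocallyPathConnectedSpace W] [LocallyPathConnectedSpace W']
    [SimplyConnectedSpace (W × ℂ)] [SimplyConnectedSpace (W' × ℂ)] (G : (W' × ℂ) ≃ₜ (W × ℂ))
    (hG : ∀ a, (G a).2 = 0 ↔ a.2 = 0) (a₀ : W' × ℂ) (b₀ : W × ℂ)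
    (h₀ : expSnd W b₀ = G (expSnd W' a₀)) :
    ∃ Λ : (W' × ℂ) ≃ₜ (W × ℂ), Λ a₀ = b₀ ∧ ∀ a, expSnd W (Λ a) = G (expSnd W' a) := by
  obtain ⟨l, hlc, hl0, hl⟩ := exists_lift_expSnd (g := fun a ↦ G (expSnd W' a))
    (G.continuous.comp continuous_expSnd)
    (fun a h ↦ expSnd_snd_ne_zero a ((hG _).1 h)) a₀ b₀ h₀
  obtain ⟨m, hmc, hm0, hm⟩ := exists_lift_expSnd (g := fun b ↦ G.symm (expSnd W b))
    (G.symm.continuous.comp continuous_expSnd)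
    (fun b h ↦ expSnd_snd_ne_zero b (by simpa using (hG _).2 h)) b₀ a₀ (by simp [h₀])
  refine ⟨⟨⟨l, m, fun a ↦ ?_, fun b ↦ ?_⟩, hlc, hmc⟩, hl0, hl⟩
  · exact congrFun (eq_of_expSnd_comp_eq (g₁ := m ∘ l) (g₂ := id) (hmc.comp hlc) continuous_id
      (fun a ↦ by simp [hm, hl]) a₀ (by simp [hl0, hm0])) a
  · exact congrFun (eq_of_expSnd_comp_eq (g₁ := l ∘ m) (g₂ := id) (hlc.comp hmc) continuous_id
      (fun b ↦ by simp [hm, hl]) b₀ (by simp [hl0, hm0])) b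

/-- For `ε > 0`, an increasing map `(0, ∞) → ℝ` onto `ℝ` that is the identity on `[ε, ∞)`. -/
noncomputable def stretch (ε t : ℝ) : ℝ := t - min t ε + (2 * ε - ε ^ 2 / min t ε)

/-- The inverse of `stretch ε`. -/
noncomputable def unstretch (ε s : ℝ) : ℝ := s - min s ε + ε ^ 2 / (2 * ε - min s ε)

theorem stretch_of_le {ε t : ℝ} (h : ε ≤ t) : stretch ε t = t := by
  rw [stretch, min_eq_right h]
  field_simp
  ring

theorem unstretch_of_le {ε t : ℝ} (h : ε ≤ t) : unstretch ε t = t := by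
  rw [unstretch, min_eq_right h]
  have : 2 * ε - ε = ε := by ring
  rw [this]
  field_simp
  ring

theorem stretch_of_ge {ε t : ℝ} (h : t ≤ ε) : stretch ε t = 2 * ε - ε ^ 2 / t := by
  rw [stretch, min_eq_left h]
  ring

theorem unstretch_of_ge {ε t : ℝ} (h : t ≤ ε) : unstretch ε t = ε ^ 2 / (2 * ε - t) := by
  rw [unstretch, min_eq_left h]
  ring

theorem stretch_le {ε t : ℝ} (ht : 0 < t) (h : t ≤ ε) : stretch ε t ≤ ε := by
  have : ε ≤ ε ^ 2 / t := by rw [le_div_iff₀ ht]; nlinarith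
  rw [stretch_of_ge h]
  linarith

theorem unstretch_le {ε t : ℝ} (hε : 0 < ε) (h : t ≤ ε) : unstretch ε t ≤ ε := by
  rw [unstretch_of_ge h, div_le_iff₀ (by linarith)]
  nlinarith

theorem unstretch_pos {ε t : ℝ} (hε : 0 < ε) : 0 < unstretch ε t := by
  rcases le_total t ε with h | h
  · rw [unstretch_of_ge h]
    have : 0 < 2 * ε - t := by linarith
    positivity
  · rw [unstretch_of_le h]
    linarith

theorem unstretch_stretch {ε t : ℝ} (hε : 0 < ε) (ht : 0 < t) :
    unstretch ε (stretch ε t) = t := by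
  rcases le_total t ε with h | h
  · rw [unstretch_of_ge (stretch_le ht h), stretch_of_ge h, sub_sub_cancel,
      div_div_cancel₀ (by positivity)]
  · rw [stretch_of_le h, unstretch_of_le h]

theorem stretch_unstretch {ε t : ℝ} (hε : 0 < ε) :
    stretch ε (unstretch ε t) = t := by
  rcases le_total t ε with h | h
  · rw [stretch_of_ge (unstretch_le hε h), unstretch_of_ge h]
    have : 2 * ε - t ≠ 0 := by linarith
    field_simp
    ring
  · rw [unstretch_of_le h, stretch_of_le h]

theorem stretch_lt {ε t c : ℝ} (ht : 0 < t) (hc : ε < c) (h : t < c) :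
    stretch ε t < c := by
  rcases le_total t ε with h' | h'
  · exact (stretch_le ht h').trans_lt hc
  · rwa [stretch_of_le h']

theorem unstretch_lt {ε t c : ℝ} (hε : 0 < ε) (hc : ε < c) (h : t < c) :
    unstretch ε t < c := by
  rcases le_total t ε with h' | h'
  · exact (unstretch_le hε h').trans_lt hc
  · rwa [unstretch_of_le h']

theorem continuous_stretch_comp {A : Type*} [TopologicalSpace A] {f g : A → ℝ} (hf : Continuous f)
    (hg : Continuous g) (hf0 : ∀ a, 0 < f a) (hg0 : ∀ a, 0 < g a) :
    Continuous fun a ↦ stretch (f a) (g a) := by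
  unfold stretch
  have : ∀ a, min (g a) (f a) ≠ 0 := fun a ↦ (lt_min (hg0 a) (hf0 a)).ne'
  fun_prop (disch := assumption)

theorem continuous_unstretch_comp {A : Type*} [TopologicalSpace A] {f g : A → ℝ}
    (hf : Continuous f) (hg : Continuous g) (hf0 : ∀ a, 0 < f a) :
    Continuous fun a ↦ unstretch (f a) (g a) := by
  unfold unstretch
  have : ∀ a, 2 * f a - min (g a) (f a) ≠ 0 := fun a ↦ by
    have := min_le_right (g a) (f a)
    have := hf0 a
    linarith
  fun_prop (disch := assumption)

/-- The open strip `{0 < im < π}` can be stretched to the whole space along the imaginary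
direction by a homeomorphism which is the identity on a prescribed closed subset. -/
theorem exists_homeomorph_strip {W : Type*} [PseudoMetricSpace W] {S : Set (W × ℂ)}
    (hS : IsClosed S) (hne : S.Nonempty) (hsub : ∀ a ∈ S, 0 < a.2.im ∧ a.2.im < π) :
    ∃ Φ : {a : W × ℂ // 0 < a.2.im ∧ a.2.im < π} ≃ₜ (W × ℂ), ∀ a, a.1 ∈ S → Φ a = a.1 := by
  obtain ⟨ε, hεc, hε0, hεπ, hεS⟩ : ∃ ε : W × ℝ → ℝ, Continuous ε ∧ (∀ b, 0 < ε b) ∧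
      (∀ b, ε b < π) ∧ ∀ a ∈ S, ε (a.1, a.2.re) ≤ a.2.im ∧ ε (a.1, a.2.re) ≤ π - a.2.im := by
    let lo : W × ℝ → W × ℂ := fun b ↦ (b.1, ⟨b.2, 0⟩)
    let hi : W × ℝ → W × ℂ := fun b ↦ (b.1, ⟨b.2, π⟩)
    have hlo : Continuous lo := by
      refine continuous_fst.prodMk ?_
      exact Complex.equivRealProdCLM.symm.continuous.comp
        (continuous_snd.prodMk (continuous_const (y := (0 : ℝ))))
    have hhi : Continuous hi := by
      refine continuous_fst.prodMk ?_
      exact Complex.equivRealProdCLM.symm.continuous.comp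
        (continuous_snd.prodMk (continuous_const (y := π)))
    have key (a : W × ℂ) (t : ℝ) : dist (a.1, (⟨a.2.re, t⟩ : ℂ)) a = |t - a.2.im| := by
      rw [Prod.dist_eq, dist_self, max_eq_right dist_nonneg]
      have h : (⟨a.2.re, t⟩ : ℂ).re = a.2.re := rfl
      exact (Complex.dist_of_re_eq h).trans (Real.dist_eq _ _)
    refine ⟨fun b ↦ min 1 (min (Metric.infDist (lo b) S) (Metric.infDist (hi b) S)), ?_, ?_, ?_, ?_⟩
    · have h1 : Continuous fun b ↦ Metric.infDist (lo b) S :=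
        (Metric.continuous_infDist_pt S).comp hlo
      have h2 : Continuous fun b ↦ Metric.infDist (hi b) S :=
        (Metric.continuous_infDist_pt S).comp hhi
      fun_prop
    · intro b
      refine lt_min one_pos (lt_min ?_ ?_)
      · exact (hS.notMem_iff_infDist_pos hne).1 fun h ↦ (hsub _ h).1.false
      · exact (hS.notMem_iff_infDist_pos hne).1 fun h ↦ (hsub _ h).2.false
    · intro b
      exact (min_le_left _ _).trans_lt (by linarith [Real.pi_gt_three])
    · intro a ha
      obtain ⟨h0, hπ⟩ := hsub a ha
      constructor
      · refine (min_le_right _ _).trans ((min_le_left _ _).trans ?_)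
        refine (Metric.infDist_le_dist_of_mem ha).trans ?_
        rw [key, zero_sub, abs_neg, abs_of_pos h0]
      · refine (min_le_right _ _).trans ((min_le_right _ _).trans ?_)
        refine (Metric.infDist_le_dist_of_mem ha).trans ?_
        rw [key, abs_of_pos (by linarith)]
  let β : W × ℂ → W × ℝ := fun a ↦ (a.1, a.2.re)
  have hβ : Continuous β := by fun_prop
  let up : W × ℂ → ℝ := fun a ↦ π - stretch (ε (β a)) (π - stretch (ε (β a)) a.2.im)
  let dn : W × ℂ → ℝ := fun a ↦ unstretch (ε (β a)) (π - unstretch (ε (β a)) (π - a.2.im))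
  have mk_cont {A : Type _} [TopologicalSpace A] {f : A → W × ℂ} {g : A → ℝ} (hf : Continuous f)
      (hg : Continuous g) : Continuous fun a ↦ ((f a).1, (⟨(f a).2.re, g a⟩ : ℂ)) := by
    refine (continuous_fst.comp hf).prodMk ?_
    exact Complex.equivRealProdCLM.symm.continuous.comp
      ((Complex.continuous_re.comp (continuous_snd.comp hf)).prodMk hg)
  refine ⟨⟨⟨fun a ↦ (a.1.1, ⟨a.1.2.re, up a.1⟩), fun a ↦ ⟨(a.1, ⟨a.2.re, dn a⟩), ?_, ?_⟩, ?_, ?_⟩,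
    ?_, ?_⟩, ?_⟩
  · exact unstretch_pos (hε0 _)
  · refine unstretch_lt (hε0 _) (hεπ _) ?_
    linarith [unstretch_pos (ε := ε (β a)) (t := π - a.2.im) (hε0 _)]
  · rintro ⟨a, h0, hπ⟩
    refine Subtype.ext (Prod.ext rfl (Complex.ext rfl ?_))
    have h1 := stretch_lt (ε := ε (β a)) h0 (hεπ _) hπ
    change unstretch (ε (β a)) (π - unstretch (ε (β a)) (π - up a)) = a.2.im
    simp only [up]
    rw [sub_sub_cancel, unstretch_stretch (hε0 _) (by linarith), sub_sub_cancel,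
      unstretch_stretch (hε0 _) h0]
  · intro a
    refine Prod.ext rfl (Complex.ext rfl ?_)
    change π - stretch (ε (β a)) (π - stretch (ε (β a)) (dn a)) = a.2.im
    simp only [dn]
    rw [stretch_unstretch (hε0 _), sub_sub_cancel, stretch_unstretch (hε0 _), sub_sub_cancel]
  · refine mk_cont continuous_subtype_val ?_
    have hc : Continuous fun a : {a : W × ℂ // 0 < a.2.im ∧ a.2.im < π} ↦ ε (β a.1) := by fun_prop
    refine continuous_const.sub (continuous_stretch_comp hc (continuous_const.sub
      (continuous_stretch_comp hc (by fun_prop) (fun _ ↦ hε0 _) fun a ↦ a.2.1))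
      (fun _ ↦ hε0 _) fun a ↦ ?_)
    linarith [stretch_lt (ε := ε (β a.1)) a.2.1 (hεπ _) a.2.2]
  · refine Continuous.subtype_mk (mk_cont continuous_id ?_) _
    have hc : Continuous fun a ↦ ε (β a) := by fun_prop
    exact continuous_unstretch_comp hc (continuous_const.sub
      (continuous_unstretch_comp hc (by fun_prop) fun _ ↦ hε0 _)) fun _ ↦ hε0 _
  · rintro ⟨a, h0, hπ⟩ ha
    refine Prod.ext rfl (Complex.ext rfl ?_)
    change π - stretch (ε (β a)) (π - stretch (ε (β a)) a.2.im) = a.2.im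
    obtain ⟨h1, h2⟩ := hεS a ha
    rw [stretch_of_le h1, stretch_of_le h2, sub_sub_cancel]

/-- A homeomorphism lifts an open half-space to the strip `{0 < im < π}` through `expSnd`. -/
theorem exists_homeomorph_halfSpace_strip {X W : Type*} [TopologicalSpace X] [TopologicalSpace W]
    (F : X ≃ₜ (W × ℂ)) :
    ∃ ℓ : {x : X // 0 < (F x).2.im} ≃ₜ {a : W × ℂ // 0 < a.2.im ∧ a.2.im < π},
      ∀ x, expSnd W (ℓ x) = F x := by
  have hne (x : {x : X // 0 < (F x).2.im}) : (F x).2 ≠ 0 := fun h ↦ by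
    have := x.2
    simp [h] at this
  have him (a : {a : W × ℂ // 0 < a.2.im ∧ a.2.im < π}) :
      0 < (F (F.symm (expSnd W a))).2.im := by
    rw [F.apply_symm_apply, expSnd, Complex.exp_im]
    exact mul_pos (Real.exp_pos _) (Real.sin_pos_of_pos_of_lt_pi a.2.1 a.2.2)
  refine ⟨⟨⟨fun x ↦ ⟨((F x).1, Complex.log (F x).2), ?_, ?_⟩,
    fun a ↦ ⟨F.symm (expSnd W a), him a⟩, fun x ↦ ?_, fun a ↦ ?_⟩, ?_, ?_⟩, fun x ↦ ?_⟩
  · have h0 : 0 ≤ (Complex.log (F x).2).im := by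
      rw [Complex.log_im]
      exact Complex.arg_nonneg_iff.2 x.2.le
    refine h0.lt_of_ne' fun h ↦ ?_
    rw [Complex.log_im, Complex.arg_eq_zero_iff] at h
    exact x.2.ne' h.2
  · rw [Complex.log_im]
    refine (Complex.arg_le_pi _).lt_of_ne fun h ↦ ?_
    rw [Complex.arg_eq_pi_iff] at h
    exact x.2.ne' h.2
  · refine Subtype.ext (F.symm_apply_eq.2 ?_)
    exact Prod.ext rfl (Complex.exp_log (hne x))
  · refine Subtype.ext (Prod.ext ?_ ?_)
    · simp [expSnd]
    · simp only [F.apply_symm_apply, expSnd]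
      exact Complex.log_exp (by linarith [a.2.1, Real.pi_pos]) a.2.2.le
  · refine Continuous.subtype_mk (Continuous.prodMk (by fun_prop) ?_) _
    exact Continuous.clog (by fun_prop) fun x ↦ Or.inr x.2.ne'
  · exact Continuous.subtype_mk
      (F.symm.continuous.comp (continuous_expSnd.comp continuous_subtype_val)) _
  · exact Prod.ext rfl (Complex.exp_log (hne x))

/-- Let `F` and `E` identify `X` with `W' × ℂ` and `W × ℂ` so that the zero sections correspond.
If the half-hyperplane `{z ∈ (0, ∞)}` of `E` lies in the half-space `{0 < im}` of `F`, then it is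
unknotted there. -/
theorem exists_homeomorph_halfSpace {X W W' : Type*} [TopologicalSpace X]
    [NormedAddCommGroup W] [NormedSpace ℝ W] [NormedAddCommGroup W'] [NormedSpace ℝ W']
    (F : X ≃ₜ (W' × ℂ)) (E : X ≃ₜ (W × ℂ)) (hFE : ∀ x, (F x).2 = 0 ↔ (E x).2 = 0)
    (hsub : ∀ x, (E x).2.im = 0 → 0 < (E x).2.re → 0 < (F x).2.im) :
    ∃ φ : {x : X // 0 < (F x).2.im} ≃ₜ (W × ℂ),
      ∀ x, (φ x).2.im = 0 ↔ (E x).2.im = 0 ∧ 0 < (E x).2.re := by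
  obtain ⟨ℓ, hℓ⟩ := exists_homeomorph_halfSpace_strip F
  let i : W × ℝ → W × ℂ := fun b ↦ (b.1, (b.2 : ℂ))
  have hi : Continuous i := by fun_prop
  have him (b : W × ℝ) : (expSnd W (i b)).2.im = 0 ∧ 0 < (expSnd W (i b)).2.re := by
    simp only [i, expSnd, Complex.exp_ofReal_im, Complex.exp_ofReal_re, Real.exp_pos, and_self]
  have hmem (b : W × ℝ) : 0 < (F (E.symm (expSnd W (i b)))).2.im := by
    refine hsub _ ?_ ?_ <;> rw [E.apply_symm_apply]
    exacts [(him b).1, (him b).2]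
  let s : W × ℝ → W' × ℂ := fun b ↦ (ℓ ⟨E.symm (expSnd W (i b)), hmem b⟩).1
  have hs : Continuous s := by
    refine continuous_subtype_val.comp (ℓ.continuous.comp (Continuous.subtype_mk ?_ _))
    exact E.symm.continuous.comp (continuous_expSnd.comp hi)
  have hs_lift (b : W × ℝ) : expSnd W' (s b) = F (E.symm (expSnd W (i b))) := hℓ _
  obtain ⟨Λ, hΛ0, hΛ⟩ := exists_homeomorph_lift_expSnd (F.symm.trans E)
    (fun a ↦ by simpa using (hFE (F.symm a)).symm) (s 0) (i 0) (by simp [hs_lift])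
  have hΛs : Λ ∘ s = i := eq_of_expSnd_comp_eq (Λ.continuous.comp hs) hi
    (fun b ↦ by simp [hΛ, hs_lift]) 0 hΛ0
  have hS {a : W' × ℂ} (ha : (Λ a).2.im = 0) : ∃ b, a = s b := by
    refine ⟨((Λ a).1, (Λ a).2.re), Λ.injective ?_⟩
    rw [← Function.comp_apply (f := Λ) (g := s), hΛs]
    exact Prod.ext rfl (Complex.ext rfl ha)
  obtain ⟨Φ, hΦ⟩ := exists_homeomorph_strip (S := {a | (Λ a).2.im = 0})
    (isClosed_eq (by fun_prop) continuous_const)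
    ⟨s 0, by simp [hΛ0, i]⟩
    (fun a ha ↦ by
      obtain ⟨b, rfl⟩ := hS ha
      exact (ℓ _).2)
  refine ⟨(ℓ.trans Φ).trans Λ, fun x ↦ ?_⟩
  have h1 : (Λ (Φ (ℓ x))).2.im = 0 ↔ (Λ (ℓ x).1).2.im = 0 := by
    refine ⟨fun h ↦ ?_, fun h ↦ by rwa [hΦ _ h]⟩
    obtain ⟨b, hb⟩ := hS h
    have h2 : Φ (ℓ x) = Φ (ℓ ⟨E.symm (expSnd W (i b)), hmem b⟩) := by
      rw [hΦ (ℓ ⟨E.symm (expSnd W (i b)), hmem b⟩)]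
      · exact hb
      · change (Λ (s b)).2.im = 0
        rw [← hb, h]
    rw [Φ.injective h2, ← hΦ]
    · rwa [← h2]
    · change (Λ (s b)).2.im = 0
      rw [← hb, h]
  have h2 : expSnd W (Λ (ℓ x).1) = E x := by simp [hΛ, hℓ]
  change (Λ (Φ (ℓ x))).2.im = 0 ↔ _
  rw [h1]
  constructor
  · intro h
    obtain ⟨b, hb⟩ := hS h
    rw [← h2, hb, ← Function.comp_apply (f := Λ) (g := s), hΛs]
    exact him b
  · rintro ⟨h3, h4⟩
    have h5 : x = ⟨E.symm (expSnd W (i ((E x).1, Real.log (E x).2.re))), hmem _⟩ := by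
      refine Subtype.ext (E.injective ?_)
      rw [E.apply_symm_apply]
      refine Prod.ext rfl ?_
      simp only [i, expSnd]
      rw [← Complex.ofReal_exp, Real.exp_log h4]
      exact Complex.ext rfl h3
    have h6 : (ℓ x).1 = s ((E x).1, Real.log (E x).2.re) := by
      simp only [s]
      rw [← h5]
    rw [h6, ← Function.comp_apply (f := Λ) (g := s), hΛs]
    exact Complex.ofReal_im _

end

/-- Splitting off the first coordinate of `ℝ^(m+1)`. -/
noncomputable def consHomeomorph (m : ℕ) : (ℝ × (Fin m → ℝ)) ≃ₜ (Fin (m + 1) → ℝ) :=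
  (Fin.consEquivL ℝ fun _ ↦ ℝ).toHomeomorph

theorem consHomeomorph_apply_zero {m : ℕ} (p : ℝ × (Fin m → ℝ)) :
    consHomeomorph m p 0 = p.1 := rfl

theorem consHomeomorph_symm_fst {m : ℕ} (x : Fin (m + 1) → ℝ) :
    ((consHomeomorph m).symm x).1 = x 0 := rfl

theorem mem_coordHyp_zero {m : ℕ} (x : Fin (m + 1) → ℝ) : x ∈ coordHyp (m + 1) 0 ↔ x 0 = 0 :=
  ⟨fun h ↦ h m.succ_pos, fun h _ ↦ h⟩

/-- The coordinate change `(y, (x, w)) ↦ (w, x + i y)`. -/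
noncomputable def toComplexHomeomorph (W : Type*) [TopologicalSpace W] :
    (ℝ × (ℝ × W)) ≃ₜ (W × ℂ) where
  toFun p := (p.2.2, Complex.equivRealProdCLM.symm (p.2.1, p.1))
  invFun a := (a.2.im, (a.2.re, a.1))
  left_inv p := rfl
  right_inv a := rfl
  continuous_toFun := by fun_prop
  continuous_invFun := by fun_prop

/-- The zero section of a product with `ℝ`, transported by a homeomorphism. -/
noncomputable def zeroSectionHomeomorph {X Y : Type*} [TopologicalSpace X] [TopologicalSpace Y]
    (e : X ≃ₜ (ℝ × Y)) {H : Set X} (hH : ∀ x, x ∈ H ↔ (e x).1 = 0) : H ≃ₜ Y where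
  toFun x := (e x).2
  invFun y := ⟨e.symm (0, y), by simp [hH]⟩
  left_inv x := by
    refine Subtype.ext (e.symm_apply_eq.2 ?_)
    exact Prod.ext ((hH x).1 x.2).symm rfl
  right_inv y := by simp
  continuous_toFun := by fun_prop
  continuous_invFun := by fun_prop

theorem IsTopoplane.exists_homeomorph {m : ℕ} {H : Set (Fin (m + 1) → ℝ)} (hH : IsTopoplane H) :
    ∃ e : (Fin (m + 1) → ℝ) ≃ₜ (ℝ × (Fin m → ℝ)), ∀ x, x ∈ H ↔ (e x).1 = 0 := by
  obtain ⟨e, he⟩ := hH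
  refine ⟨e.trans (consHomeomorph m).symm, fun x ↦ ?_⟩
  rw [← e.injective.mem_set_image, he, mem_coordHyp_zero]
  rfl

theorem IsRelTopoplane.exists_homeomorph {n : ℕ} {Y Z : Set (Fin n → ℝ)}
    (hZ : IsRelTopoplane Y Z) :
    ∃ k, ∃ φ : Y ≃ₜ (ℝ × (Fin k → ℝ)), ∀ y : Y, (y : Fin n → ℝ) ∈ Z ↔ (φ y).1 = 0 := by
  obtain ⟨-, d, hd, φ, hφ⟩ := hZ
  obtain ⟨k, rfl⟩ := Nat.exists_eq_add_of_le' hd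
  refine ⟨k, φ.trans (consHomeomorph k).symm, fun y ↦ ?_⟩
  change y ∈ {y : Y | (y : Fin n → ℝ) ∈ Z} ↔ _
  rw [← φ.injective.mem_set_image, hφ, mem_coordHyp_zero]
  rfl

/-- A topoplane and a relative topoplane in it can be flattened simultaneously. -/
theorem IsTopoplane.exists_homeomorph_complex {m : ℕ} {H L : Set (Fin (m + 1) → ℝ)}
    (hH : IsTopoplane H) (hL : IsRelTopoplane H L) :
    ∃ k, ∃ F : (Fin (m + 1) → ℝ) ≃ₜ ((Fin k → ℝ) × ℂ),
      (∀ x, x ∈ H ↔ (F x).2.im = 0) ∧ ∀ x, x ∈ L ↔ (F x).2 = 0 := by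
  obtain ⟨e, he⟩ := hH.exists_homeomorph
  obtain ⟨k, φ, hφ⟩ := hL.exists_homeomorph
  let ψ := (zeroSectionHomeomorph e he).symm.trans φ
  refine ⟨k, (e.trans ((Homeomorph.refl ℝ).prodCongr ψ)).trans (toComplexHomeomorph _), he,
    fun x ↦ ?_⟩
  have key (hx : x ∈ H) : ψ (e x).2 = φ ⟨x, hx⟩ :=
    congrArg φ ((zeroSectionHomeomorph e he).symm_apply_apply ⟨x, hx⟩)
  change x ∈ L ↔ (⟨(ψ (e x).2).1, (e x).1⟩ : ℂ) = 0
  rw [Complex.ext_iff]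
  constructor
  · intro hx
    have hxH := hL.1 hx
    exact ⟨by rw [key hxH]; exact (hφ _).1 hx, (he x).1 hxH⟩
  · rintro ⟨h1, h2⟩
    have hxH := (he x).2 h2
    refine (hφ ⟨x, hxH⟩).2 ?_
    rw [← key hxH]
    exact h1

/-- A component of the complement of the zero set of a continuous function `r` is a sign domain
of `r` as soon as the latter is preconnected. -/
theorem connectedComponentIn_eq_setOf_pos {X : Type*} [TopologicalSpace X] {S : Set X} {r : X → ℝ}
    (hr : Continuous r) (hS : ∀ y ∈ S, r y ≠ 0) {x : X} (hx : x ∈ S) (hx0 : 0 < r x)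
    (hpos : IsPreconnected {y | y ∈ S ∧ 0 < r y}) :
    connectedComponentIn S x = {y | y ∈ S ∧ 0 < r y} := by
  refine Subset.antisymm (fun y hy ↦ ?_)
    (hpos.subset_connectedComponentIn ⟨hx, hx0⟩ fun y hy ↦ hy.1)
  have hyS := connectedComponentIn_subset S x hy
  refine ⟨hyS, not_le.1 fun hy0 ↦ ?_⟩
  obtain ⟨z, hz, hz0⟩ := isPreconnected_connectedComponentIn.intermediate_value hy
    (mem_connectedComponentIn hx) hr.continuousOn ⟨hy0, hx0.le⟩
  exact hS z (connectedComponentIn_subset S x hz) hz0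

theorem Homeomorph.isPreconnected_setOf_comp {X Y : Type*} [TopologicalSpace X]
    [TopologicalSpace Y] (e : X ≃ₜ Y) {p : Y → Prop} (hp : IsPreconnected {y | p y}) :
    IsPreconnected {x | p (e x)} :=
  e.isPreconnected_preimage.2 hp

/-- A topoplane has disconnected complement, so no relative topoplane of another topoplane is
itself a topoplane. -/
theorem IsTopoplane.not_isRelTopoplane {m : ℕ} {H H' : Set (Fin (m + 1) → ℝ)}
    (hH : IsTopoplane H) (hH' : IsTopoplane H') : ¬ IsRelTopoplane H' H := by
  intro h
  obtain ⟨e, he⟩ := hH.exists_homeomorph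
  obtain ⟨k, E, -, hE⟩ := hH'.exists_homeomorph_complex h
  have hpre : IsPreconnected {x | (E x).2 ∈ ({0}ᶜ : Set ℂ)} := by
    refine E.isPreconnected_setOf_comp (p := fun a ↦ a.2 ∈ ({0}ᶜ : Set ℂ)) ?_
    have h1 : IsPreconnected ({0}ᶜ : Set ℂ) :=
      (isConnected_compl_singleton_of_one_lt_rank (by simp) 0).isPreconnected
    convert isPreconnected_univ (α := Fin k → ℝ).prod h1 using 1
    ext a
    simp
  have hmem (t : ℝ) (ht : t ≠ 0) : e.symm (t, 0) ∈ {x | (E x).2 ∈ ({0}ᶜ : Set ℂ)} := by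
    change (E (e.symm (t, 0))).2 ≠ 0
    rw [Ne, ← hE, he]
    simpa using ht
  obtain ⟨z, hz, hz0⟩ := hpre.intermediate_value (hmem (-1) (by simp)) (hmem 1 (by simp))
    (f := fun x ↦ (e x).1) (by fun_prop) (show (0 : ℝ) ∈ _ by simp)
  exact hz ((hE z).1 ((he z).2 hz0))

/-- Let `H₁ ∩ H₂` be a relative topoplane in each of the topoplanes `H₁` and `H₂`. Then every
component of `H₂ \ H₁` is a relative topoplane in the component of `H₁ᶜ` containing it. -/
theorem IsTopoplane.isRelTopoplane_connectedComponentIn {m : ℕ} {H₁ H₂ : Set (Fin (m + 1) → ℝ)}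
    (h₁ : IsTopoplane H₁) (h₂ : IsTopoplane H₂) (hL₁ : IsRelTopoplane H₁ (H₁ ∩ H₂))
    (hL₂ : IsRelTopoplane H₂ (H₁ ∩ H₂)) {x z : Fin (m + 1) → ℝ} (hx : x ∈ H₁ᶜ) (hz : z ∈ H₂ \ H₁)
    (hsub : connectedComponentIn (H₂ \ H₁) z ⊆ connectedComponentIn H₁ᶜ x) :
    IsRelTopoplane (connectedComponentIn H₁ᶜ x) (connectedComponentIn (H₂ \ H₁) z) := by
  obtain ⟨k', F, hF, hFL, hFx⟩ : ∃ k, ∃ F : (Fin (m + 1) → ℝ) ≃ₜ ((Fin k → ℝ) × ℂ),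
      (∀ x, x ∈ H₁ ↔ (F x).2.im = 0) ∧ (∀ x, x ∈ H₁ ∩ H₂ ↔ (F x).2 = 0) ∧ 0 < (F x).2.im := by
    obtain ⟨k, F, hF, hFL⟩ := h₁.exists_homeomorph_complex hL₁
    rcases lt_or_gt_of_ne (fun h ↦ hx ((hF x).2 h) : (F x).2.im ≠ 0) with h | h
    · refine ⟨k, F.trans ((Homeomorph.refl _).prodCongr (Homeomorph.neg ℂ)), fun y ↦ ?_, fun y ↦ ?_,
        ?_⟩
      · simp [hF]
      · simp [hFL]
      · simpa using h
    · exact ⟨k, F, hF, hFL, h⟩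
  obtain ⟨k, E, hE, hEL, hEz⟩ : ∃ k, ∃ E : (Fin (m + 1) → ℝ) ≃ₜ ((Fin k → ℝ) × ℂ),
      (∀ x, x ∈ H₂ ↔ (E x).2.im = 0) ∧ (∀ x, x ∈ H₁ ∩ H₂ ↔ (E x).2 = 0) ∧ 0 < (E z).2.re := by
    obtain ⟨k, E, hE, hEL⟩ := h₂.exists_homeomorph_complex hL₂
    have hne : (E z).2.re ≠ 0 := fun h ↦
      hz.2 ((hEL z).2 (Complex.ext h ((hE z).1 hz.1))).1
    rcases lt_or_gt_of_ne hne with h | h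
    · refine ⟨k, E.trans ((Homeomorph.refl _).prodCongr (Homeomorph.neg ℂ)), fun y ↦ ?_, fun y ↦ ?_,
        ?_⟩
      · simp [hE]
      · simp [hEL]
      · simpa using h
    · exact ⟨k, E, hE, hEL, h⟩
  have hX : connectedComponentIn H₁ᶜ x = {y | 0 < (F y).2.im} := by
    have heq : {y | y ∈ H₁ᶜ ∧ 0 < (F y).2.im} = {y | 0 < (F y).2.im} := by
      ext y
      exact ⟨fun h ↦ h.2, fun h ↦ ⟨fun hy ↦ h.ne' ((hF y).1 hy), h⟩⟩
    rw [← heq]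
    refine connectedComponentIn_eq_setOf_pos (S := H₁ᶜ) (r := fun y ↦ (F y).2.im) (by fun_prop)
      (fun y hy h ↦ hy ((hF y).2 h)) hx hFx ?_
    rw [heq]
    refine F.isPreconnected_setOf_comp (p := fun a ↦ 0 < a.2.im) (Convex.isPreconnected ?_)
    exact convex_halfSpace_gt (f := fun a : (Fin k' → ℝ) × ℂ ↦ a.2.im)
      ⟨by simp, by simp⟩ 0
  have hZ : connectedComponentIn (H₂ \ H₁) z = {y | (E y).2.im = 0 ∧ 0 < (E y).2.re} := by
    have heq : {y | y ∈ H₂ \ H₁ ∧ 0 < (E y).2.re} = {y | (E y).2.im = 0 ∧ 0 < (E y).2.re} := by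
      ext y
      refine ⟨fun h ↦ ⟨(hE y).1 h.1.1, h.2⟩, fun h ↦ ?_⟩
      have hy := (hE y).2 h.1
      refine ⟨⟨hy, fun hy₁ ↦ h.2.ne' ?_⟩, h.2⟩
      rw [(hEL y).1 ⟨hy₁, hy⟩, Complex.zero_re]
    rw [← heq]
    refine connectedComponentIn_eq_setOf_pos (S := H₂ \ H₁) (r := fun y ↦ (E y).2.re)
      (by fun_prop)
      (fun y hy h ↦ hy.2 ((hEL y).2 (Complex.ext h ((hE y).1 hy.1))).1) hz hEz ?_
    rw [heq]
    refine E.isPreconnected_setOf_comp (p := fun a ↦ a.2.im = 0 ∧ 0 < a.2.re)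
      (Convex.isPreconnected ?_)
    exact (convex_hyperplane (f := fun a : (Fin k → ℝ) × ℂ ↦ a.2.im) ⟨by simp, by simp⟩ 0).inter
      (convex_halfSpace_gt (f := fun a : (Fin k → ℝ) × ℂ ↦ a.2.re) ⟨by simp, by simp⟩ 0)
  refine ⟨hsub, k + 2, by simp, ?_⟩
  rw [hX, hZ] at hsub ⊢
  obtain ⟨φ, hφ⟩ := exists_homeomorph_halfSpace F E (fun y ↦ by rw [← hFL, ← hEL])
    fun y h1 h2 ↦ hsub ⟨h1, h2⟩
  let ψ : ((Fin k → ℝ) × ℂ) ≃ₜ (Fin (k + 2) → ℝ) := (toComplexHomeomorph _).symm.trans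
    (((Homeomorph.refl ℝ).prodCongr (consHomeomorph k)).trans (consHomeomorph (k + 1)))
  have hψ (a : (Fin k → ℝ) × ℂ) : ψ a 0 = a.2.im := rfl
  refine ⟨φ.trans ψ, ?_⟩
  ext v
  obtain ⟨y, rfl⟩ := (φ.trans ψ).surjective v
  rw [(φ.trans ψ).injective.mem_set_image, mem_coordHyp_zero]
  exact (hφ y).symm

/-- let `H₁, H₂` be distinct intersecting topoplanes of an arrangement `𝓗`
in `ℝⁿ`, let `X₊` be a connected component of `ℝⁿ ∖ H₁`, and let `Z₊` be a connected
component of `H₂ ∖ H₁` with `Z₊ ⊆ X₊`.  Then `Z₊` is a relative topoplane in `X₊`. -/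
theorem statement5 {n : ℕ} (hn : 1 ≤ n) (𝓗 : Set (Set (Fin n → ℝ)))
    (h𝓗 : IsArrangement 𝓗) (H₁ H₂ : Set (Fin n → ℝ))
    (h₁ : H₁ ∈ 𝓗) (h₂ : H₂ ∈ 𝓗) (hne : H₁ ≠ H₂) (hmeet : (H₁ ∩ H₂).Nonempty)
    (Xp : Set (Fin n → ℝ)) (hXp : ∃ x ∈ H₁ᶜ, Xp = connectedComponentIn H₁ᶜ x)
    (Zp : Set (Fin n → ℝ)) (hZp : ∃ x ∈ H₂ \ H₁, Zp = connectedComponentIn (H₂ \ H₁) x)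
    (hsub : Zp ⊆ Xp) :
    IsRelTopoplane Xp Zp := by
  obtain ⟨m, rfl⟩ := Nat.exists_eq_add_of_le' hn
  obtain ⟨x, hx, rfl⟩ := hXp
  obtain ⟨z, hz, rfl⟩ := hZp
  obtain ⟨-, htopo, hrel⟩ := h𝓗
  have hflat {H : Set (Fin (m + 1) → ℝ)} (hH : H ∈ 𝓗) (hH0 : H.Nonempty) : IsFlat 𝓗 H :=
    ⟨⟨{H}, by simpa using hH, by simp⟩, hH0⟩
  have hL₂ : IsRelTopoplane H₂ (H₁ ∩ H₂) := by
    rcases hrel H₁ h₁ H₂ (hflat h₂ hmeet.right) with h | h | h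
    · exact absurd (h hz.1) hz.2
    · exact absurd h hmeet.ne_empty
    · exact h
  have hL₁ : IsRelTopoplane H₁ (H₁ ∩ H₂) := by
    rcases hrel H₂ h₂ H₁ (hflat h₁ hmeet.left) with h | h | h
    · rw [inter_eq_left.2 h] at hL₂
      exact absurd hL₂ ((htopo H₁ h₁).not_isRelTopoplane (htopo H₂ h₂))
    · rw [inter_comm] at h
      exact absurd h hmeet.ne_empty
    · rwa [inter_comm] at h
  exact (htopo H₁ h₁).isRelTopoplane_connectedComponentIn (htopo H₂ h₂) hL₁ hL₂ hx hz hsub
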